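/- Let Γ be a group with a convergence action on a perfect, compact metric space Z. Then the action is uniform if and only if every point of Z is intrinsically conical. -/

import Mathlib

open Filter Metric Set Topology

/-- A sequence in a group diverges to infinity if it eventually leaves every finite subset. -/
def DivergesToInfinity {G : Type*} (γ : ℕ → G) : Prop :=
  ∀ F : Finset G, {n : ℕ | γ n ∈ F}.Finite

/-- A convergence action: every sequence diverging to infinity has a subsequence converging,
uniformly on compact subsets of the complement of an exceptional point, to a constant map. -/
def ConvergenceAction (G Z : Type*) [Group G] [MetricSpace Z] [MulAction G Z] : Prop :=
  ∀ γ : ℕ → G, DivergesToInfinity γ →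
    ∃ (zp zm : Z) (k : ℕ → ℕ), StrictMono k ∧
      ∀ K : Set Z, IsCompact K → K ⊆ {zm}ᶜ →
        TendstoUniformlyOn (fun i z => γ (k i) • z) (fun _ => zp) atTop K

/-- The space of triples of pairwise distinct points. -/
def tripSet (Z : Type*) : Set (Z × Z × Z) :=
  {p | p.1 ≠ p.2.1 ∧ p.1 ≠ p.2.2 ∧ p.2.1 ≠ p.2.2}

/-- An action is uniform if the diagonal action on the space of triples of pairwise distinct
points is cocompact. -/
def UniformAction (G Z : Type*) [Group G] [MetricSpace Z] [MulAction G Z] : Prop :=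
  ∃ K : Set (Z × Z × Z), K ⊆ tripSet Z ∧ IsCompact K ∧
    ∀ p ∈ tripSet Z, ∃ γ : G, (γ • p.1, γ • p.2.1, γ • p.2.2) ∈ K

/-- A point `z` is intrinsically conical if there is a sequence `γ n → ∞` in the group such
that `γ n⁻¹ • z` converges to some `a` and the maps `γ n⁻¹` converge, uniformly on compact
subsets of `Z ∖ {z}`, to a constant `b ≠ a`. -/
def IntrinsicallyConical (G : Type*) {Z : Type*} [Group G] [MetricSpace Z] [MulAction G Z]
    (z : Z) : Prop :=
  ∃ (γ : ℕ → G) (a b : Z), DivergesToInfinity γ ∧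
    Tendsto (fun n => (γ n)⁻¹ • z) atTop (𝓝 a) ∧
    (∀ K : Set Z, IsCompact K → K ⊆ {z}ᶜ →
      TendstoUniformlyOn (fun n w => (γ n)⁻¹ • w) (fun _ => b) atTop K) ∧
    b ≠ a

/-- At least two of the three coordinates of the triple lie in the set. -/
def TwoIn {Z : Type*} (S : Set Z) (p : Z × Z × Z) : Prop :=
  (p.1 ∈ S ∧ p.2.1 ∈ S) ∨ (p.1 ∈ S ∧ p.2.2 ∈ S) ∨ (p.2.1 ∈ S ∧ p.2.2 ∈ S)

/-- The annuli `g⁻¹(A, B)` and `g'⁻¹(A, B)` are nested. -/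
def AnnulusLT {G Z : Type*} [Group G] [MulAction G Z] (A B : Set Z) (g g' : G) : Prop :=
  ∀ z : Z, g • z ∉ A → g' • z ∈ B

/-- A chain of nested translates of the annulus `(A, B)` separating the triple `o` from the
triple `p`. -/
def IsAnnulusChain {G Z : Type*} [Group G] [MulAction G Z] (A B : Set Z) (o p : Z × Z × Z)
    (l : List G) : Prop :=
  l.Pairwise (AnnulusLT A B) ∧ ∀ g ∈ l, TwoIn B (g • o) ∧ TwoIn A (g • p)

/-- The largest length of a chain of nested translates of `(A, B)` separating `o` from `p`. -/
noncomputable def annulusDist (G : Type*) {Z : Type*} [Group G] [MulAction G Z] (A B : Set Z)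
    (o p : Z × Z × Z) : ℕ :=
  sSup {n | ∃ l : List G, IsAnnulusChain A B o p l ∧ l.length = n}

/-- The group elements sending two of the points of `o` to `B` and two `r`-separated points
to `A`. -/
def straddlers (G : Type*) {Z : Type*} [Group G] [MetricSpace Z] [MulAction G Z] (A B : Set Z)
    (o : Z × Z × Z) (r : ℝ) : Set G :=
  {g | TwoIn B (g • o) ∧ ∃ x y : Z, r ≤ dist x y ∧ g • x ∈ A ∧ g • y ∈ A}

section TwoIn

variable {Z : Type*} {S T : Set Z} {p : Z × Z × Z}

lemma TwoIn.mono (h : TwoIn S p) (hST : S ⊆ T) : TwoIn T p := by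
  rcases h with h | h | h
  · exact Or.inl ⟨hST h.1, hST h.2⟩
  · exact Or.inr (Or.inl ⟨hST h.1, hST h.2⟩)
  · exact Or.inr (Or.inr ⟨hST h.1, hST h.2⟩)

lemma TwoIn.exists_mem (h : TwoIn S p) (h' : TwoIn T p) :
    ∃ x, (x = p.1 ∨ x = p.2.1 ∨ x = p.2.2) ∧ x ∈ S ∧ x ∈ T := by
  unfold TwoIn at h h'
  by_cases h1 : p.1 ∈ S ∧ p.1 ∈ T
  · exact ⟨_, Or.inl rfl, h1⟩
  by_cases h2 : p.2.1 ∈ S ∧ p.2.1 ∈ T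
  · exact ⟨_, Or.inr (Or.inl rfl), h2⟩
  · exact ⟨_, Or.inr (Or.inr rfl), by tauto⟩

lemma twoIn_compl_singleton (hp : p ∈ tripSet Z) (z : Z) : TwoIn {z}ᶜ p := by
  obtain ⟨h1, h2, h3⟩ := hp
  simp only [TwoIn, mem_compl_iff, mem_singleton_iff]
  by_cases e1 : p.1 = z
  · subst e1
    exact Or.inr (Or.inr ⟨h1.symm, h2.symm⟩)
  · by_cases e2 : p.2.1 = z
    · subst e2
      exact Or.inr (Or.inl ⟨e1, h3.symm⟩)
    · exact Or.inl ⟨e1, e2⟩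

lemma twoIn_smul_iff {G : Type*} [Group G] [MulAction G Z] (g : G) :
    TwoIn S (g • p) ↔ TwoIn {z | g • z ∈ S} p := Iff.rfl

lemma smul_mem_tripSet {G : Type*} [Group G] [MulAction G Z] (hp : p ∈ tripSet Z) (g : G) :
    g • p ∈ tripSet Z := by
  obtain ⟨h1, h2, h3⟩ := hp
  exact ⟨fun h => h1 (smul_left_cancel g h), fun h => h2 (smul_left_cancel g h),
    fun h => h3 (smul_left_cancel g h)⟩

end TwoIn

lemma divergesToInfinity_of_injective {G : Type*} {γ : ℕ → G} (h : Function.Injective γ) :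
    DivergesToInfinity γ := fun F => F.finite_toSet.preimage h.injOn

lemma TendstoUniformlyOn.mem_closure_of_forall_exists {Y Z : Type*} [PseudoMetricSpace Z]
    {f : ℕ → Y → Z} {c : Z} {K : Set Y} {A : Set Z}
    (h : TendstoUniformlyOn f (fun _ => c) atTop K) (hA : ∀ n, ∃ q ∈ K, f n q ∈ A) :
    c ∈ closure A := by
  rw [Metric.mem_closure_iff]
  intro ε hε
  obtain ⟨n, hn⟩ := (Metric.tendstoUniformlyOn_iff.1 h ε hε).exists
  obtain ⟨q, hq, hqA⟩ := hA n
  exact ⟨_, hqA, hn q hq⟩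

lemma TendstoUniformlyOn.tendsto_of_eventually_mem {Y Z : Type*} [PseudoMetricSpace Z]
    {f : ℕ → Y → Z} {c : Z} {K : Set Y} {u : ℕ → Y}
    (h : TendstoUniformlyOn f (fun _ => c) atTop K) (hu : ∀ᶠ n in atTop, u n ∈ K) :
    Tendsto (fun n => f n (u n)) atTop (𝓝 c) := by
  rw [Metric.tendsto_nhds]
  intro ε hε
  filter_upwards [Metric.tendstoUniformlyOn_iff.1 h ε hε, hu] with n hn hun
  rw [dist_comm]
  exact hn _ hun

lemma ConvergenceAction.finite_straddlers {G Z : Type*} [Group G] [MetricSpace Z]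
    [CompactSpace Z] [MulAction G Z] (hconv : ConvergenceAction G Z) {A B : Set Z}
    (hAB : Disjoint (closure A) (closure B)) {o : Z × Z × Z} (ho : o ∈ tripSet Z) {r : ℝ}
    (hr : 0 < r) : (straddlers G A B o r).Finite := by
  by_contra hinf
  have e := Set.Infinite.natEmbedding _ hinf
  obtain ⟨zp, zm, k, -, hk⟩ := hconv (fun n => (e n : G))
    (divergesToInfinity_of_injective (Subtype.val_injective.comp e.injective))
  refine Set.disjoint_left.1 hAB
    ((hk (ball zm (r / 2))ᶜ isOpen_ball.isClosed_compl.isCompact ?_).mem_closure_of_forall_exists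
      fun n => ?_)
    ((hk ({o.1, o.2.1, o.2.2} ∩ {zm}ᶜ) ?_ inter_subset_right).mem_closure_of_forall_exists
      fun n => ?_)
  · exact compl_subset_compl.2 (singleton_subset_iff.2 (mem_ball_self (half_pos hr)))
  · obtain ⟨-, x, y, hxy, hx, hy⟩ := (e (k n)).2
    by_cases h : x ∈ ball zm (r / 2)
    · refine ⟨y, fun h' => ?_, hy⟩
      have := dist_triangle_right x y zm
      rw [mem_ball] at h h'
      linarith
    · exact ⟨x, h, hx⟩
  · exact ((Set.toFinite _).subset inter_subset_left).isCompact
  · obtain ⟨h, -⟩ := (e (k n)).2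
    obtain ⟨x, hx, hxB, hxm⟩ :=
      ((twoIn_smul_iff _).1 h).exists_mem (twoIn_compl_singleton ho zm)
    exact ⟨x, ⟨by simpa using hx, hxm⟩, hxB⟩

section Chains

variable {G Z : Type*} [Group G] [MulAction G Z] {A B : Set Z} {o p : Z × Z × Z}

lemma AnnulusLT.ne (hne : A ∪ B ≠ univ) {g g' : G} (h : AnnulusLT A B g g') : g ≠ g' := by
  rintro rfl
  refine hne (eq_univ_of_forall fun z => ?_)
  by_cases hz : z ∈ A
  · exact Or.inl hz
  · have := h (g⁻¹ • z)
    rw [smul_inv_smul] at this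
    exact Or.inr (this hz)

lemma IsAnnulusChain.nodup (hne : A ∪ B ≠ univ) {l : List G} (hl : IsAnnulusChain A B o p l) :
    l.Nodup := hl.1.imp fun h => h.ne hne

lemma List.Nodup.length_le_ncard {α : Type*} {l : List α} (hl : l.Nodup) {S : Set α}
    (hS : S.Finite) (h : ∀ x ∈ l, x ∈ S) : l.length ≤ S.ncard := by
  classical
  rw [← List.toFinset_card_of_nodup hl, ← Set.ncard_coe_finset]
  exact Set.ncard_le_ncard (fun x hx => h x (by simpa using hx)) hS

lemma bddAbove_chain_length {Z : Type*} [MetricSpace Z] [MulAction G Z] {A B : Set Z}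
    {o p : Z × Z × Z} (hne : A ∪ B ≠ univ)
    (hfin : ∀ r > 0, (straddlers G A B o r).Finite) (hp : p ∈ tripSet Z) :
    BddAbove {n | ∃ l : List G, IsAnnulusChain A B o p l ∧ l.length = n} := by
  obtain ⟨r, hr, h1, h2, h3⟩ : ∃ r > 0, r ≤ dist p.1 p.2.1 ∧ r ≤ dist p.1 p.2.2 ∧
      r ≤ dist p.2.1 p.2.2 := by
    refine ⟨min (dist p.1 p.2.1) (min (dist p.1 p.2.2) (dist p.2.1 p.2.2)), ?_, by simp⟩
    have := hp
    simp only [tripSet, Set.mem_ofPred_eq] at this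
    simp [dist_pos, this]
  refine ⟨(straddlers G A B o r).ncard, ?_⟩
  rintro _ ⟨l, hl, rfl⟩
  refine (hl.nodup hne).length_le_ncard (hfin r hr) fun g hg => ⟨(hl.2 g hg).1, ?_⟩
  rcases (hl.2 g hg).2 with h | h | h
  · exact ⟨_, _, h1, h⟩
  · exact ⟨_, _, h2, h⟩
  · exact ⟨_, _, h3, h⟩

/-- Translating a triple `p` by an element `h` which contracts most of `o` to `W` and most of
`p` to `U` shortens the annulus distance by the length of any chain `q` between `o` and
`h⁻¹ • o`, up to a bounded error. -/
lemma length_add_annulusDist_le {Z : Type*} [MetricSpace Z] [MulAction G Z] {A B : Set Z}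
    {o p : Z × Z × Z} (hne : A ∪ B ≠ univ)
    (hfin : ∀ r > 0, (straddlers G A B o r).Finite) (hp : p ∈ tripSet Z) {h : G} {U W : Set Z}
    {r : ℝ} (hr : 0 < r) (hUW : ∀ x ∈ U, ∀ y ∈ W, r ≤ dist x y) (hU : TwoIn U (h • p))
    (hW : TwoIn W (h • o)) {q : List G} (hq : IsAnnulusChain A B o p q)
    (hqW : ∀ g ∈ q, ∀ z, g • z ∉ A → h • z ∈ W) :
    q.length + annulusDist G A B o (h • p) ≤
      annulusDist G A B o p + ((straddlers G A B o r).ncard + 1) := by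
  set C := (straddlers G A B o r).ncard with hC
  obtain ⟨l, hl, hlen⟩ : annulusDist G A B o (h • p) ∈
      {n | ∃ l : List G, IsAnnulusChain A B o (h • p) l ∧ l.length = n} :=
    Nat.sSup_mem ⟨0, [], by simp [IsAnnulusChain], rfl⟩
      (bddAbove_chain_length hne hfin (smul_mem_tripSet hp h))
  have hsplit := hl.1
  rw [← List.take_append_drop (C + 1) l, List.pairwise_append] at hsplit
  obtain ⟨-, hdrop, hcross⟩ := hsplit
  have hB : ∀ f ∈ l.drop (C + 1), ∀ w ∈ W, f • w ∈ B := by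
    intro f hf w hw
    obtain ⟨g, hg, hgS⟩ : ∃ g ∈ l.take (C + 1), g ∉ straddlers G A B o r := by
      by_contra! hcon
      have h1 := ((hl.nodup hne).sublist (List.take_sublist _ _)).length_le_ncard
        (hfin r hr) hcon
      have h2 := List.length_pos_of_mem hf
      rw [List.length_take] at h1
      rw [List.length_drop] at h2
      omega
    refine hcross g hg f hf w fun hgw => hgS ?_
    obtain ⟨ho, hA⟩ := hl.2 g (List.mem_of_mem_take hg)
    obtain ⟨x, -, hxU, hxA⟩ := hU.exists_mem ((twoIn_smul_iff g).1 hA)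
    exact ⟨ho, x, w, hUW x hxU w hw, hxA, hgw⟩
  have hchain : IsAnnulusChain A B o p (q ++ (l.drop (C + 1)).map (· * h)) := by
    refine ⟨List.pairwise_append.2 ⟨hq.1, ?_, ?_⟩, ?_⟩
    · rw [List.pairwise_map]
      refine hdrop.imp fun {a b} hab z hz => ?_
      rw [mul_smul] at hz ⊢
      exact hab _ hz
    · intro g hg f' hf' z hz
      obtain ⟨f, hf, rfl⟩ := List.mem_map.1 hf'
      rw [mul_smul]
      exact hB f hf _ (hqW g hg z hz)
    · intro g hg
      rcases List.mem_append.1 hg with hg | hg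
      · exact hq.2 g hg
      · obtain ⟨f, hf, rfl⟩ := List.mem_map.1 hg
        rw [mul_smul, mul_smul]
        exact ⟨(twoIn_smul_iff f).2 (hW.mono fun w hw => hB f hf w hw),
          (hl.2 f (List.mem_of_mem_drop hf)).2⟩
  have : (q ++ (l.drop (C + 1)).map (· * h)).length ≤ annulusDist G A B o p :=
    le_csSup (bddAbove_chain_length hne hfin hp) ⟨_, hchain, rfl⟩
  rw [List.length_append, List.length_map, List.length_drop, hlen] at this
  omega

end Chains

lemma exists_seq_annuli (Z : Type*) [MetricSpace Z] [CompactSpace Z] {o : Z × Z × Z}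
    (ho : o ∈ tripSet Z) :
    ∃ A B : ℕ → Set Z, (∀ t, IsOpen (A t) ∧ IsOpen (B t) ∧
      Disjoint (closure (A t)) (closure (B t)) ∧ A t ∪ B t ≠ univ) ∧
      ∀ a b, a ≠ b → ∃ t, a ∈ A t ∧ b ∈ B t := by
  let b := TopologicalSpace.countableBasis Z
  have hb := TopologicalSpace.isBasis_countableBasis Z
  let P : Set (Set Z × Set Z) := {u | (u.1 ∈ b ∧ u.2 ∈ b) ∧
    Disjoint (closure u.1) (closure u.2) ∧ u.1 ∪ u.2 ≠ univ}
  have hP : P.Countable :=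
    ((TopologicalSpace.countable_countableBasis Z).prod
      (TopologicalSpace.countable_countableBasis Z)).mono fun u hu => Set.mem_prod.2 hu.1
  have hsep : ∀ x y : Z, x ≠ y → ∃ u ∈ P, x ∈ u.1 ∧ y ∈ u.2 := by
    intro x y hxy
    obtain ⟨c, hcx, hcy⟩ : ∃ c, c ≠ x ∧ c ≠ y := by
      obtain ⟨c, -, hcx, hcy⟩ :=
        (twoIn_compl_singleton ho x).exists_mem (twoIn_compl_singleton ho y)
      exact ⟨c, hcx, hcy⟩
    obtain ⟨V, V', hV, hV', hxV, hyV, hVV⟩ := t2_separation hxy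
    have key : ∀ {x : Z} {V : Set Z}, IsOpen V → x ∈ V → c ≠ x →
        ∃ u ∈ b, x ∈ u ∧ closure u ⊆ V ∧ c ∉ u := by
      intro x V hV hx hc
      obtain ⟨u, hu, hxu, huV⟩ := hb.exists_closure_subset
        ((hV.inter isOpen_compl_singleton).mem_nhds ⟨hx, hc.symm⟩)
      exact ⟨u, hu, hxu, huV.trans inter_subset_left, fun h => (huV (subset_closure h)).2 rfl⟩
    obtain ⟨u, hu, hxu, huV, hcu⟩ := key hV hxV hcx
    obtain ⟨v, hv, hyv, hvV, hcv⟩ := key hV' hyV hcy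
    refine ⟨(u, v), ⟨⟨hu, hv⟩, hVV.mono huV hvV, fun h => ?_⟩, hxu, hyv⟩
    have hc : c ∈ u ∪ v := h ▸ mem_univ c
    exact hc.elim hcu hcv
  obtain ⟨u₀, hu₀, -⟩ := hsep _ _ ho.1
  obtain ⟨f, hf⟩ := hP.exists_eq_range ⟨u₀, hu₀⟩
  have hmem : ∀ t, f t ∈ P := fun t => hf ▸ mem_range_self t
  refine ⟨fun t => (f t).1, fun t => (f t).2, fun t => ⟨hb.isOpen (hmem t).1.1,
    hb.isOpen (hmem t).1.2, (hmem t).2⟩, fun x y hxy => ?_⟩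
  obtain ⟨u, hu, hxu⟩ := hsep x y hxy
  rw [hf] at hu
  obtain ⟨t, rfl⟩ := hu
  exact ⟨t, hxu⟩

section Conical

variable {G Z : Type*} [Group G] [MetricSpace Z] [CompactSpace Z] [MulAction G Z]
  {g : ℕ → G} {a b ζ : Z} {A B : Set Z}

lemma eventually_forall_smul_mem (hcont : ∀ γ : G, Continuous fun z : Z => γ • z)
    (hg : ∀ K : Set Z, IsCompact K → K ⊆ {ζ}ᶜ →
      TendstoUniformlyOn (fun n w => g n • w) (fun _ => b) atTop K)
    (hA : IsOpen A) {V : Set Z} (hV : V ∈ 𝓝 b) {f : G} (hf : f • ζ ∈ A) :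
    ∀ᶠ n in atTop, ∀ z, f • z ∉ A → g n • z ∈ V := by
  obtain ⟨ε, hε, hεV⟩ := Metric.mem_nhds_iff.1 hV
  have hK : IsCompact {z | f • z ∉ A} := (hA.isClosed_compl.preimage (hcont f)).isCompact
  filter_upwards [Metric.tendstoUniformlyOn_iff.1 (hg _ hK
    fun z hz h => hz (by rw [mem_singleton_iff.1 h]; exact hf)) ε hε] with n hn z hz
  exact hεV (by rw [mem_ball, dist_comm]; exact hn z hz)

omit [CompactSpace Z] in
lemma eventually_twoIn
    (hg : ∀ K : Set Z, IsCompact K → K ⊆ {ζ}ᶜ →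
      TendstoUniformlyOn (fun n w => g n • w) (fun _ => b) atTop K)
    {V : Set Z} (hV : V ∈ 𝓝 b) {o : Z × Z × Z} (ho : o ∈ tripSet Z) :
    ∀ᶠ n in atTop, TwoIn V (g n • o) := by
  obtain ⟨ε, hε, hεV⟩ := Metric.mem_nhds_iff.1 hV
  have hK : ({o.1, o.2.1, o.2.2} ∩ {ζ}ᶜ : Set Z).Finite :=
    (Set.toFinite _).subset inter_subset_left
  filter_upwards [Metric.tendstoUniformlyOn_iff.1 (hg _ hK.isCompact inter_subset_right) ε hε]
    with n hn
  have hn' : ∀ z ∈ ({o.1, o.2.1, o.2.2} ∩ {ζ}ᶜ : Set Z), g n • z ∈ V := fun z hz =>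
    hεV (by rw [mem_ball, dist_comm]; exact hn z hz)
  rcases twoIn_compl_singleton ho ζ with h | h | h
  · exact Or.inl ⟨hn' _ ⟨by simp, h.1⟩, hn' _ ⟨by simp, h.2⟩⟩
  · exact Or.inr (Or.inl ⟨hn' _ ⟨by simp, h.1⟩, hn' _ ⟨by simp, h.2⟩⟩)
  · exact Or.inr (Or.inr ⟨hn' _ ⟨by simp, h.1⟩, hn' _ ⟨by simp, h.2⟩⟩)

/-- A conical point lies inside arbitrarily long chains of nested annuli. -/
lemma exists_chain_of_conical (hcont : ∀ γ : G, Continuous fun z : Z => γ • z)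
    (hζ : Tendsto (fun n => g n • ζ) atTop (𝓝 a))
    (hg : ∀ K : Set Z, IsCompact K → K ⊆ {ζ}ᶜ →
      TendstoUniformlyOn (fun n w => g n • w) (fun _ => b) atTop K)
    (hA : IsOpen A) (hB : IsOpen B) (haA : a ∈ A) (hbB : b ∈ B) {o : Z × Z × Z}
    (ho : o ∈ tripSet Z) (J : ℕ) :
    ∃ q : List G, q.length = J ∧ q.Pairwise (AnnulusLT A B) ∧
      ∀ f ∈ q, TwoIn B (f • o) ∧ f • ζ ∈ A := by
  induction J with
  | zero => exact ⟨[], by simp⟩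
  | succ J ih =>
    obtain ⟨q, hlen, hpw, hq⟩ := ih
    have h1 : ∀ᶠ n in atTop, ∀ f ∈ {f | f ∈ q}, ∀ z, f • z ∉ A → g n • z ∈ B :=
      (Filter.eventually_all_finite (List.finite_toSet q)).2 fun f hf =>
        eventually_forall_smul_mem hcont hg hA (hB.mem_nhds hbB) (hq f hf).2
    obtain ⟨n, hn1, hn2, hn3⟩ := (h1.and ((eventually_twoIn hg (hB.mem_nhds hbB) ho).and
      (hζ.eventually (hA.mem_nhds haA)))).exists
    refine ⟨q ++ [g n], by simp [hlen], List.pairwise_append.2 ⟨hpw, by simp, ?_⟩, ?_⟩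
    · intro f hf f' hf'
      rw [List.mem_singleton.1 hf']
      exact hn1 f hf
    · intro f hf
      rcases List.mem_append.1 hf with hf | hf
      · exact hq f hf
      · rw [List.mem_singleton.1 hf]
        exact ⟨hn2, hn3⟩

end Conical

lemma isCompact_separated_triples {Z : Type*} [MetricSpace Z] [CompactSpace Z] (r : ℝ) :
    IsCompact {p : Z × Z × Z | r ≤ dist p.1 p.2.1 ∧ r ≤ dist p.1 p.2.2 ∧
      r ≤ dist p.2.1 p.2.2} := by
  simp only [Set.ofPred_and]
  exact ((isClosed_le continuous_const (by fun_prop)).inter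
    ((isClosed_le continuous_const (by fun_prop)).inter
      (isClosed_le continuous_const (by fun_prop)))).isCompact

lemma exists_accumulation_of_not_separated {Z : Type*} [MetricSpace Z] [CompactSpace Z]
    {p : ℕ → Z × Z × Z} (hp : ∀ n : ℕ, ¬ (1 / ((n : ℝ) + 1) ≤ dist (p n).1 (p n).2.1 ∧
      1 / ((n : ℝ) + 1) ≤ dist (p n).1 (p n).2.2 ∧
      1 / ((n : ℝ) + 1) ≤ dist (p n).2.1 (p n).2.2)) :
    ∃ ζ : Z, ∀ U ∈ 𝓝 ζ, ∃ᶠ n in atTop, TwoIn U (p n) := by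
  have h : ∀ n : ℕ, ∃ x y : Z, dist x y < 1 / ((n : ℝ) + 1) ∧
      ∀ S : Set Z, x ∈ S → y ∈ S → TwoIn S (p n) := by
    intro n
    have := hp n
    rw [not_and_or, not_and_or, not_le, not_le, not_le] at this
    rcases this with h | h | h
    · exact ⟨_, _, h, fun S hx hy => Or.inl ⟨hx, hy⟩⟩
    · exact ⟨_, _, h, fun S hx hy => Or.inr (Or.inl ⟨hx, hy⟩)⟩
    · exact ⟨_, _, h, fun S hx hy => Or.inr (Or.inr ⟨hx, hy⟩)⟩
  choose x y hxy hS using h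
  obtain ⟨ζ, k, hk, hx⟩ := CompactSpace.tendsto_subseq x
  have hy : Tendsto (y ∘ k) atTop (𝓝 ζ) :=
    (tendsto_iff_of_dist (squeeze_zero (fun _ => dist_nonneg) (fun n => (hxy (k n)).le)
      (tendsto_one_div_add_atTop_nhds_zero_nat.comp hk.tendsto_atTop))).1 hx
  refine ⟨ζ, fun U hU => hk.tendsto_atTop.frequently (Eventually.frequently ?_)⟩
  filter_upwards [hx.eventually hU, hy.eventually hU] with n h1 h2
  exact hS _ _ h1 h2

lemma exists_le_add_one_of_nonneg {ι : Type*} [Nonempty ι] {f : ι → ℝ} (hf : ∀ i, 0 ≤ f i) :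
    ∃ i, ∀ j, f i ≤ f j + 1 := by
  obtain ⟨i, hi⟩ := exists_lt_of_ciInf_lt (lt_add_one (⨅ i, f i))
  have hbdd : BddBelow (range f) := ⟨0, forall_mem_range.2 hf⟩
  exact ⟨i, fun j => hi.le.trans (by gcongr; exact ciInf_le hbdd j)⟩

/-- Weights making the diagonal and all its shifts summable. -/
lemma exists_weights (C : ℕ → ℕ → ℕ) : ∃ c : ℕ → ℝ, (∀ t, 0 < c t) ∧
    ∀ s, Summable fun t => c t * C t (max t s) := by
  refine ⟨fun t => (1 / 2) ^ t / (C t t + 1), fun t => by positivity, fun s => ?_⟩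
  refine Summable.of_norm_bounded_eventually_nat summable_geometric_two ?_
  filter_upwards [eventually_ge_atTop s] with t ht
  rw [max_eq_left ht, Real.norm_of_nonneg (by positivity), div_mul_eq_mul_div]
  refine div_le_of_le_mul₀ (by positivity) (by positivity) ?_
  gcongr
  linarith

lemma uniformAction_of_forall_intrinsicallyConical {G Z : Type*} [Group G] [MetricSpace Z]
    [CompactSpace Z] [MulAction G Z] (hcont : ∀ γ : G, Continuous fun z : Z => γ • z)
    (hconv : ConvergenceAction G Z) (hcon : ∀ z : Z, IntrinsicallyConical G z) :
    UniformAction G Z := by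
  by_contra hnot
  have hbad : ∀ n : ℕ, ∃ p ∈ tripSet Z, ∀ g : G,
      ¬ (1 / ((n : ℝ) + 1) ≤ dist (g • p).1 (g • p).2.1 ∧
        1 / ((n : ℝ) + 1) ≤ dist (g • p).1 (g • p).2.2 ∧
        1 / ((n : ℝ) + 1) ≤ dist (g • p).2.1 (g • p).2.2) := by
    intro n
    by_contra! h
    have hn : 0 < 1 / ((n : ℝ) + 1) := by positivity
    exact hnot ⟨_, fun p hp => ⟨dist_pos.1 (hn.trans_le hp.1), dist_pos.1 (hn.trans_le hp.2.1),
      dist_pos.1 (hn.trans_le hp.2.2)⟩, isCompact_separated_triples (1 / ((n : ℝ) + 1)), h⟩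
  choose p₀ hp₀ hsep₀ using hbad
  have ho := hp₀ 0
  set o := p₀ 0
  obtain ⟨A, B, hAB, htype⟩ := exists_seq_annuli Z ho
  have hfin : ∀ t, ∀ r > 0, (straddlers G (A t) (B t) o r).Finite := fun t r hr =>
    hconv.finite_straddlers (hAB t).2.2.1 ho hr
  obtain ⟨c, hc, hsum⟩ := exists_weights fun t s =>
    (straddlers G (A t) (B t) o (1 / ((s : ℝ) + 1))).ncard + 1
  have hmin : ∀ n, ∃ g₀ : G, ∀ g : G,
      ∑ t ∈ Finset.range n, c t * annulusDist G (A t) (B t) o (g₀ • p₀ n) ≤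
      ∑ t ∈ Finset.range n, c t * annulusDist G (A t) (B t) o (g • p₀ n) + 1 := fun n =>
    exists_le_add_one_of_nonneg
      (f := fun g : G => ∑ t ∈ Finset.range n, c t * annulusDist G (A t) (B t) o (g • p₀ n))
      fun g => Finset.sum_nonneg fun t _ => mul_nonneg (hc t).le (Nat.cast_nonneg _)
  choose g₀ hg₀ using hmin
  obtain ⟨ζ, hζ⟩ := exists_accumulation_of_not_separated (p := fun n => g₀ n • p₀ n)
    fun n => hsep₀ n (g₀ n)
  obtain ⟨γ, a, b, -, hγa, hγb, hba⟩ := hcon ζ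
  obtain ⟨t₀, ha, hb⟩ := htype a b hba.symm
  obtain ⟨s, hs⟩ := exists_nat_one_div_lt (div_pos (dist_pos.2 hba.symm) three_pos)
  set δ := dist a b / 3 with hδ
  have hδ0 : 0 < δ := div_pos (dist_pos.2 hba.symm) three_pos
  set L := ∑' t, c t * (((straddlers G (A t) (B t) o
    (1 / (((max t s : ℕ) : ℝ) + 1))).ncard + 1 : ℕ) : ℝ) with hL
  obtain ⟨J, hJ⟩ := exists_nat_gt ((L + 1) / c t₀)
  rw [div_lt_iff₀' (hc t₀)] at hJ
  obtain ⟨q, hqlen, hqpw, hq⟩ := exists_chain_of_conical hcont hγa hγb (hAB t₀).1 (hAB t₀).2.1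
    ha hb ho J
  have h1 : ∀ᶠ n in atTop, ∀ f ∈ {f | f ∈ q}, ∀ z, f • z ∉ A t₀ → (γ n)⁻¹ • z ∈ ball b δ :=
    (Filter.eventually_all_finite (List.finite_toSet q)).2 fun f hf =>
      eventually_forall_smul_mem hcont hγb (hAB t₀).1 (ball_mem_nhds b hδ0) (hq f hf).2
  obtain ⟨k, hk1, hk2, hk3⟩ := (h1.and ((eventually_twoIn hγb (ball_mem_nhds b hδ0) ho).and
    (hγa.eventually (ball_mem_nhds a hδ0)))).exists
  set h := (γ k)⁻¹ with hh
  have hN : ∀ᶠ z in 𝓝 ζ, h • z ∈ ball a δ ∧ ∀ f ∈ {f | f ∈ q}, f • z ∈ A t₀ :=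
    ((hcont h).continuousAt.eventually (isOpen_ball.mem_nhds hk3)).and
      ((Filter.eventually_all_finite (List.finite_toSet q)).2 fun f hf =>
        (hcont f).continuousAt.eventually ((hAB t₀).1.mem_nhds (hq f hf).2))
  obtain ⟨n, hn, hnt⟩ := ((hζ _ hN).and_eventually (eventually_gt_atTop t₀)).exists
  set p := g₀ n • p₀ n with hpdef
  have hp : p ∈ tripSet Z := smul_mem_tripSet (hp₀ n) _
  have hUW : ∀ t : ℕ, ∀ x ∈ ball a δ, ∀ y ∈ ball b δ,
      1 / (((max t s : ℕ) : ℝ) + 1) ≤ dist x y := by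
    intro t x hx y hy
    have h1 : 1 / (((max t s : ℕ) : ℝ) + 1) ≤ 1 / ((s : ℝ) + 1) := by
      gcongr
      exact le_max_right t s
    have h2 := dist_triangle4_right a b x y
    have h3 := dist_triangle4 a x y b
    rw [mem_ball] at hx hy
    rw [dist_comm a x] at h3
    linarith
  have hstep : ∀ t, ∀ q : List G, IsAnnulusChain (A t) (B t) o p q →
      (∀ g ∈ q, ∀ z, g • z ∉ A t → h • z ∈ ball b δ) →
      (q.length : ℝ) + annulusDist G (A t) (B t) o (h • p) ≤ annulusDist G (A t) (B t) o p +
        (((straddlers G (A t) (B t) o (1 / (((max t s : ℕ) : ℝ) + 1))).ncard + 1 : ℕ) : ℝ) := by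
    intro t q hq hqW
    exact_mod_cast length_add_annulusDist_le (hAB t).2.2.2 (hfin t) hp (by positivity) (hUW t)
      (hn.mono fun z hz => hz.1) hk2 hq hqW
  have htot : ∑ t ∈ Finset.range n, c t * ((if t = t₀ then (J : ℝ) else 0) +
      annulusDist G (A t) (B t) o (h • p)) ≤
      ∑ t ∈ Finset.range n, c t * (annulusDist G (A t) (B t) o p +
        (((straddlers G (A t) (B t) o (1 / (((max t s : ℕ) : ℝ) + 1))).ncard + 1 : ℕ) : ℝ)) := by
    refine Finset.sum_le_sum fun t _ => mul_le_mul_of_nonneg_left ?_ (hc t).le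
    split_ifs with ht
    · subst ht
      rw [← hqlen]
      exact hstep t q ⟨hqpw, fun f hf => ⟨(hq f hf).1,
        (twoIn_smul_iff f).2 (hn.mono fun z hz => hz.2 f hf)⟩⟩ hk1
    · exact_mod_cast hstep t [] ⟨List.Pairwise.nil, by simp⟩ (by simp)
  simp only [mul_add, Finset.sum_add_distrib, mul_ite, mul_zero, Finset.sum_ite_eq',
    Finset.mem_range, hnt, if_true] at htot
  have hle : ∑ t ∈ Finset.range n, c t * (((straddlers G (A t) (B t) o
      (1 / (((max t s : ℕ) : ℝ) + 1))).ncard + 1 : ℕ) : ℝ) ≤ L :=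
    (hsum s).sum_le_tsum _ fun t _ => mul_nonneg (hc t).le (Nat.cast_nonneg _)
  have hm := hg₀ n (h * g₀ n)
  rw [mul_smul, ← hpdef] at hm
  push_cast [mul_add, Finset.sum_add_distrib] at htot hle
  linarith

lemma UniformAction.intrinsicallyConical {G Z : Type*} [Group G] [MetricSpace Z]
    [CompactSpace Z] [MulAction G Z] (hcont : ∀ γ : G, Continuous fun z : Z => γ • z)
    (hperf : ∀ z : Z, ¬ IsOpen ({z} : Set Z)) (hconv : ConvergenceAction G Z)
    (hunif : UniformAction G Z) (z : Z) : IntrinsicallyConical G z := by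
  obtain ⟨K, hKT, hK, hcov⟩ := hunif
  have hclose : ∀ ε > 0, ∃ x, x ≠ z ∧ dist x z < ε := by
    intro ε hε
    by_contra! h
    refine hperf z (Metric.isOpen_singleton_iff.2 ⟨ε, hε, fun y hy => ?_⟩)
    by_contra hne
    exact (h y hne).not_gt hy
  obtain ⟨y, hyz, -⟩ := hclose 1 one_pos
  have hx : ∀ n : ℕ, ∃ x, x ≠ z ∧ x ≠ y ∧ dist x z < 1 / ((n : ℝ) + 1) := by
    intro n
    obtain ⟨x, hxz, hx⟩ := hclose (min (1 / ((n : ℝ) + 1)) (dist y z))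
      (lt_min (by positivity) (dist_pos.2 hyz))
    exact ⟨x, hxz, fun h => (h ▸ hx).not_ge (min_le_right _ _), hx.trans_le (min_le_left _ _)⟩
  choose x hxz hxy hxd using hx
  have hxlim : Tendsto x atTop (𝓝 z) := tendsto_iff_dist_tendsto_zero.2
    (squeeze_zero (fun _ => dist_nonneg) (fun n => (hxd n).le)
      tendsto_one_div_add_atTop_nhds_zero_nat)
  choose g hg using fun n => hcov (z, x n, y) ⟨(hxz n).symm, hyz.symm, hxy n⟩
  obtain ⟨⟨a, c, b⟩, habc, k, hk, hlim⟩ := hK.tendsto_subseq hg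
  obtain ⟨hac, hab, hcb⟩ := hKT habc
  simp only at hac hab hcb
  have hla : Tendsto (fun n => g (k n) • z) atTop (𝓝 a) :=
    (continuous_fst.tendsto _).comp hlim
  have hlc : Tendsto (fun n => g (k n) • x (k n)) atTop (𝓝 c) :=
    ((continuous_fst.comp continuous_snd).tendsto _).comp hlim
  have hlb : Tendsto (fun n => g (k n) • y) atTop (𝓝 b) :=
    ((continuous_snd.comp continuous_snd).tendsto _).comp hlim
  have hxk : Tendsto (x ∘ k) atTop (𝓝 z) := hxlim.comp hk.tendsto_atTop
  have hdiv : DivergesToInfinity fun n => g (k n) := by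
    intro F
    by_contra hinf
    obtain ⟨f, -, hf⟩ : ∃ f ∈ F, {n | g (k n) = f}.Infinite := by
      by_contra! h
      refine hinf ((F.finite_toSet.biUnion h).subset ?_)
      intro n hn
      exact mem_biUnion hn rfl
    have hfr : ∃ᶠ n in atTop, g (k n) = f := Nat.frequently_atTop_iff_infinite.2 hf
    have hfx : Tendsto (fun n => f • x (k n)) atTop (𝓝 (f • z)) := ((hcont f).tendsto z).comp hxk
    have hfreq : ∀ {u : ℕ → Z} {l l' : Z}, Tendsto (fun n => g (k n) • u n) atTop (𝓝 l) →
        Tendsto (fun n => f • u n) atTop (𝓝 l') → l = l' := by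
      intro u l l' h h'
      by_contra hne
      obtain ⟨V, V', hV, hV', hl, hl', hVV⟩ := t2_separation hne
      obtain ⟨n, hn, hn1, hn2⟩ := (hfr.and_eventually
        ((h.eventually (hV.mem_nhds hl)).and (h'.eventually (hV'.mem_nhds hl')))).exists
      rw [hn] at hn1
      exact Set.disjoint_left.1 hVV hn1 hn2
    exact hac ((hfreq hla tendsto_const_nhds).trans (hfreq hlc hfx).symm)
  obtain ⟨zp, zm, j, hj, hu⟩ := hconv _ hdiv
  have hjt := hj.tendsto_atTop
  have hzm : zm = z := by
    by_contra hne
    have hr : 0 < dist z zm / 2 := half_pos (dist_pos.2 (Ne.symm hne))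
    have hV := hu (ball zm (dist z zm / 2))ᶜ isOpen_ball.isClosed_compl.isCompact
      (compl_subset_compl.2 (singleton_subset_iff.2 (mem_ball_self hr)))
    have hVz : (ball zm (dist z zm / 2))ᶜ ∈ 𝓝 z := by
      filter_upwards [isClosed_closedBall.isOpen_compl.mem_nhds
        (show z ∈ (closedBall zm (dist z zm / 2))ᶜ by
          simp only [mem_compl_iff, mem_closedBall, not_le]; linarith)] with w hw hw'
      exact hw (ball_subset_closedBall hw')
    refine hac ((tendsto_nhds_unique (b := zp) (hla.comp hjt) ?_).trans
      (tendsto_nhds_unique (hlc.comp hjt) ?_).symm)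
    · exact hV.tendsto_of_eventually_mem (.of_forall fun _ => mem_of_mem_nhds hVz)
    · exact hV.tendsto_of_eventually_mem (u := fun n => x (k (j n)))
        ((hxk.comp hjt).eventually hVz)
  subst hzm
  have hzp : zp = b := tendsto_nhds_unique
    ((hu {y} isCompact_singleton (by simpa using hyz.symm)).tendsto_at rfl) (hlb.comp hjt)
  subst hzp
  refine ⟨fun n => (g (k (j n)))⁻¹, a, zp, ?_, ?_, ?_, hab.symm⟩
  · intro F
    classical
    refine ((hdiv (F.image (·⁻¹))).preimage hj.injective.injOn).subset fun n hn => ?_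
    exact Finset.mem_image.2 ⟨_, hn, inv_inv _⟩
  · simpa only [inv_inv, Function.comp_def] using hla.comp hjt
  · simpa using hu

/-- Bowditch–Tukia: a convergence action on a perfect compact metric space is uniform if and
only if every point is intrinsically conical. -/
theorem uniform_iff_all_points_intrinsically_conical
    {G Z : Type*} [Group G] [MetricSpace Z] [CompactSpace Z] [MulAction G Z]
    (hcont : ∀ γ : G, Continuous fun z : Z => γ • z)
    (hperf : ∀ z : Z, ¬ IsOpen ({z} : Set Z))
    (hconv : ConvergenceAction G Z) :
    UniformAction G Z ↔ ∀ z : Z, IntrinsicallyConical G z := by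
  exact ⟨fun h => h.intrinsicallyConical hcont hperf hconv,
    uniformAction_of_forall_intrinsicallyConical hcont hconv⟩
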